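/- Let a, b, c, d, s, t be integers with a+t ≥ b ≥ a+s and c+t ≥ d ≥ c+s. The number of lattice paths from (a,b) to (c,d) with steps (1,0) and (0,1), all of whose points (x,y) satisfy x+t ≥ y ≥ x+s, equals the (finitely supported) sum over all k ∈ ℤ of C(c+d−a−b, c−a−k(t−s+2)) − C(c+d−a−b, c−b−k(t−s+2)+t+1). -/

import Mathlib

/-- The set of lattice paths (as lists of their points) from `A` to `E` in `ℤ²`
with steps `(1,0)` and `(0,1)`, all of whose points satisfy the condition `C`. -/
def SPaths (A E : ℤ × ℤ) (C : ℤ × ℤ → Prop) : Set (List (ℤ × ℤ)) :=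
  {p | p.head? = some A ∧ p.getLast? = some E ∧
       List.Chain' (fun q q' => q' - q = ((1 : ℤ), (0 : ℤ)) ∨ q' - q = ((0 : ℤ), (1 : ℤ))) p ∧
       ∀ q ∈ p, C q}

/-- Binomial coefficient `C(n,k)` for integer arguments, `0` unless `0 ≤ k ≤ n`. -/
def ibinom (n k : ℤ) : ℤ :=
  if 0 ≤ k ∧ k ≤ n then (Nat.choose n.toNat k.toNat : ℤ) else 0

theorem ibinom_natCast (n k : ℕ) : ibinom n k = n.choose k := by
  unfold ibinom
  split_ifs with h
  · simp
  · rw [Nat.choose_eq_zero_of_lt (by omega), Nat.cast_zero]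

theorem ibinom_of_neg_left {n : ℤ} (hn : n < 0) (k : ℤ) : ibinom n k = 0 :=
  if_neg (by omega)

theorem ibinom_of_neg_right (n : ℤ) {k : ℤ} (hk : k < 0) : ibinom n k = 0 :=
  if_neg (by omega)

theorem ibinom_zero_left (k : ℤ) : ibinom 0 k = if k = 0 then 1 else 0 := by
  unfold ibinom
  split_ifs with h h' h'
  · simp [h']
  · omega
  · omega
  · rfl

/-- Pascal's rule. -/
theorem ibinom_eq_add {n : ℤ} (hn : 0 < n) (k : ℤ) :
    ibinom n k = ibinom (n - 1) (k - 1) + ibinom (n - 1) k := by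
  obtain ⟨N, rfl⟩ : ∃ N : ℕ, n = (N + 1 : ℕ) := ⟨(n - 1).toNat, by omega⟩
  have hN : ((N + 1 : ℕ) : ℤ) - 1 = (N : ℕ) := by omega
  rcases lt_trichotomy k 0 with hk | rfl | hk
  · simp [ibinom_of_neg_right _ hk, ibinom_of_neg_right _ (show k - 1 < 0 by omega)]
  · rw [ibinom_of_neg_right _ (show (0 : ℤ) - 1 < 0 by omega), hN, ← Nat.cast_zero,
      ibinom_natCast, ibinom_natCast]
    simp
  · obtain ⟨K, rfl⟩ : ∃ K : ℕ, k = (K + 1 : ℕ) := ⟨(k - 1).toNat, by omega⟩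
    have hK : ((K + 1 : ℕ) : ℤ) - 1 = (K : ℕ) := by omega
    rw [hN, hK, ibinom_natCast, ibinom_natCast, ibinom_natCast, Nat.choose_succ_succ,
      Nat.cast_add]

theorem finite_support_ibinom_sub_mul (n x : ℤ) {m : ℤ} (hm : 0 < m) :
    (Function.support fun k : ℤ => ibinom n (x - k * m)).Finite := by
  refine (Set.finite_Icc (-(|n| + |x|)) (|n| + |x|)).subset fun k hk => ?_
  have h : 0 ≤ x - k * m ∧ x - k * m ≤ n := by
    by_contra h
    exact hk (if_neg h)
  have hx := le_abs_self x
  have hx' := neg_abs_le x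
  have hn := le_abs_self n
  have hn' := abs_nonneg n
  have hxnn := abs_nonneg x
  constructor
  · by_contra! hlt
    nlinarith
  · by_contra! hlt
    nlinarith

/-- The sum of the binomial coefficients `C(n, x - k m)` over all `k`. -/
noncomputable def ibinomSum (m n x : ℤ) : ℤ := ∑ᶠ k : ℤ, ibinom n (x - k * m)

theorem ibinomSum_of_neg (m : ℤ) {n : ℤ} (hn : n < 0) (x : ℤ) : ibinomSum m n x = 0 := by
  simp [ibinomSum, ibinom_of_neg_left hn]

theorem ibinomSum_eq_add {m n : ℤ} (hm : 0 < m) (hn : 0 < n) (x : ℤ) :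
    ibinomSum m n x = ibinomSum m (n - 1) (x - 1) + ibinomSum m (n - 1) x := by
  unfold ibinomSum
  rw [← finsum_add_distrib (finite_support_ibinom_sub_mul _ _ hm)
    (finite_support_ibinom_sub_mul _ _ hm)]
  refine finsum_congr fun k => ?_
  rw [ibinom_eq_add hn, sub_right_comm]

theorem ibinomSum_add_period (m n x : ℤ) : ibinomSum m n (x + m) = ibinomSum m n x := by
  unfold ibinomSum
  rw [← finsum_comp_equiv (Equiv.addRight (1 : ℤ))]
  refine finsum_congr fun k => ?_
  congr 1
  simp only [Equiv.coe_addRight]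
  ring

theorem ibinomSum_zero_zero {m : ℤ} (hm : 0 < m) : ibinomSum m 0 0 = 1 := by
  unfold ibinomSum
  rw [finsum_eq_single _ 0]
  · simp [ibinom_zero_left]
  · intro k hk
    rw [ibinom_zero_left, if_neg]
    simp [hk, hm.ne']

theorem ibinomSum_zero_of_not_dvd {m x : ℤ} (hx : ¬ m ∣ x) : ibinomSum m 0 x = 0 := by
  unfold ibinomSum
  refine finsum_eq_zero_of_forall_eq_zero fun k => ?_
  rw [ibinom_zero_left, if_neg]
  intro h
  exact hx ⟨k, by linarith⟩

theorem SPaths_eq_empty_of_not {A E : ℤ × ℤ} {C : ℤ × ℤ → Prop} (h : ¬ C A) :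
    SPaths A E C = ∅ := by
  refine Set.eq_empty_of_forall_notMem fun p hp => h (hp.2.2.2 A ?_)
  exact List.mem_of_head? hp.1

theorem cons_cons_mem_SPaths {A B q E : ℤ × ℤ} {C : ℤ × ℤ → Prop} {l : List (ℤ × ℤ)} :
    B :: q :: l ∈ SPaths A E C ↔
      B = A ∧ C A ∧ (q = A + (1, 0) ∨ q = A + (0, 1)) ∧ q :: l ∈ SPaths q E C := by
  simp only [SPaths, Set.mem_ofPred_eq, List.Chain', List.head?_cons, Option.some.injEq, List.getLast?_cons_cons,
    List.isChain_cons_cons, List.forall_mem_cons, sub_eq_iff_eq_add']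
  constructor
  · rintro ⟨rfl, h1, ⟨h2, h3⟩, h4, h5⟩
    exact ⟨rfl, h4, h2, trivial, h1, h3, h5⟩
  · rintro ⟨rfl, h4, h2, -, h1, h3, h5⟩
    exact ⟨rfl, h1, ⟨h2, h3⟩, h4, h5⟩

theorem singleton_mem_SPaths {A B E : ℤ × ℤ} {C : ℤ × ℤ → Prop} :
    [B] ∈ SPaths A E C ↔ B = A ∧ A = E ∧ C A := by
  simp only [SPaths, Set.mem_ofPred_eq, List.Chain', List.head?_cons, Option.some.injEq, List.getLast?_singleton,
    List.isChain_singleton, List.mem_singleton, forall_eq, true_and]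
  constructor
  · rintro ⟨rfl, rfl, h⟩
    exact ⟨rfl, rfl, h⟩
  · rintro ⟨rfl, rfl, h⟩
    exact ⟨rfl, rfl, h⟩

theorem nil_notMem_SPaths {A E : ℤ × ℤ} {C : ℤ × ℤ → Prop} : [] ∉ SPaths A E C := by
  simp [SPaths]

theorem sum_le_of_mem_SPaths {A E : ℤ × ℤ} {C : ℤ × ℤ → Prop} {p : List (ℤ × ℤ)}
    (hp : p ∈ SPaths A E C) : A.1 + A.2 ≤ E.1 + E.2 := by
  induction p generalizing A with
  | nil => exact absurd hp nil_notMem_SPaths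
  | cons B l ih =>
    cases l with
    | nil =>
      obtain ⟨-, rfl, -⟩ := singleton_mem_SPaths.1 hp
      exact le_rfl
    | cons q l =>
      obtain ⟨-, -, hq, hl⟩ := cons_cons_mem_SPaths.1 hp
      have h := ih hl
      rcases hq with rfl | rfl <;> simp only [Prod.fst_add, Prod.snd_add] at h <;> omega

theorem SPaths_eq_empty_of_lt {A E : ℤ × ℤ} {C : ℤ × ℤ → Prop}
    (h : E.1 + E.2 < A.1 + A.2) : SPaths A E C = ∅ :=
  Set.eq_empty_of_forall_notMem fun _ hp => (sum_le_of_mem_SPaths hp).not_gt h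

theorem SPaths_self {A : ℤ × ℤ} {C : ℤ × ℤ → Prop} (h : C A) : SPaths A A C = {[A]} := by
  refine Set.eq_singleton_iff_unique_mem.2 ⟨singleton_mem_SPaths.2 ⟨rfl, rfl, h⟩, fun p hp => ?_⟩
  match p with
  | [] => exact absurd hp nil_notMem_SPaths
  | [B] => rw [(singleton_mem_SPaths.1 hp).1]
  | B :: q :: l =>
    obtain ⟨-, -, hq, hl⟩ := cons_cons_mem_SPaths.1 hp
    have h := sum_le_of_mem_SPaths hl
    rcases hq with rfl | rfl <;> simp only [Prod.fst_add, Prod.snd_add] at h <;> omega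

/-- A path between distinct points starts with one of the two steps. -/
theorem SPaths_eq_image_union {A E : ℤ × ℤ} {C : ℤ × ℤ → Prop} (h : C A) (hne : A ≠ E) :
    SPaths A E C =
      List.cons A '' (SPaths (A + (1, 0)) E C ∪ SPaths (A + (0, 1)) E C) := by
  ext p
  constructor
  · intro hp
    match p with
    | [] => exact absurd hp nil_notMem_SPaths
    | [B] => exact absurd (singleton_mem_SPaths.1 hp).2.1 hne
    | B :: q :: l =>
      obtain ⟨rfl, -, hq, hl⟩ := cons_cons_mem_SPaths.1 hp
      exact ⟨q :: l, by rcases hq with rfl | rfl <;> simp [hl], rfl⟩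
  · rintro ⟨p, hp, rfl⟩
    match p with
    | [] => exact hp.elim (absurd · nil_notMem_SPaths) (absurd · nil_notMem_SPaths)
    | q :: l =>
      refine cons_cons_mem_SPaths.2 ⟨rfl, h, ?_⟩
      rcases hp with hp | hp
      · obtain rfl : q = _ := Option.some.inj hp.1
        exact ⟨Or.inl rfl, hp⟩
      · obtain rfl : q = _ := Option.some.inj hp.1
        exact ⟨Or.inr rfl, hp⟩

theorem disjoint_SPaths {A B E : ℤ × ℤ} {C : ℤ × ℤ → Prop} (h : A ≠ B) :
    Disjoint (SPaths A E C) (SPaths B E C) :=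
  Set.disjoint_left.2 fun _ hA hB => h (Option.some.inj (hA.1.symm.trans hB.1))

theorem SPaths_finite_and_ncard {A E : ℤ × ℤ} {C : ℤ × ℤ → Prop} (h : C A) (hne : A ≠ E)
    (h₁ : (SPaths (A + (1, 0)) E C).Finite) (h₂ : (SPaths (A + (0, 1)) E C).Finite) :
    (SPaths A E C).Finite ∧ (SPaths A E C).ncard =
      (SPaths (A + (1, 0)) E C).ncard + (SPaths (A + (0, 1)) E C).ncard := by
  rw [SPaths_eq_image_union h hne]
  refine ⟨(h₁.union h₂).image _, ?_⟩
  rw [Set.ncard_image_of_injective _ (List.cons_injective),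
    Set.ncard_union_eq (disjoint_SPaths (by simp)) h₁ h₂]

/-- The reflection formula, also for starting points on the two lines just outside the strip. -/
theorem SPaths_strip_finite_and_ncard (c d s t : ℤ) (hst : s ≤ t) (h3 : c + s ≤ d)
    (h4 : d ≤ c + t) (n : ℕ) (a b : ℤ) (hn : c + d - a - b = n - 1)
    (h1 : a + s - 1 ≤ b) (h2 : b ≤ a + t + 1) :
    (SPaths (a, b) (c, d) (fun q => q.1 + s ≤ q.2 ∧ q.2 ≤ q.1 + t)).Finite ∧
    ((SPaths (a, b) (c, d) (fun q => q.1 + s ≤ q.2 ∧ q.2 ≤ q.1 + t)).ncard : ℤ)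
      = ibinomSum (t - s + 2) (c + d - a - b) (c - a)
        - ibinomSum (t - s + 2) (c + d - a - b) (c - b + t + 1) := by
  have hm : 0 < t - s + 2 := by omega
  induction n generalizing a b with
  | zero =>
    rw [SPaths_eq_empty_of_lt (by simp only; omega), ibinomSum_of_neg _ (by omega),
      ibinomSum_of_neg _ (by omega)]
    simp
  | succ n ih =>
    by_cases hC : a + s ≤ b ∧ b ≤ a + t
    · by_cases hne : (a, b) = (c, d)
      · obtain ⟨rfl, rfl⟩ := Prod.mk.inj hne
        rw [SPaths_self hC]
        have hdvd : ¬ (t - s + 2) ∣ (a - b + t + 1) := fun h => by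
          have := Int.le_of_dvd (by omega) h
          omega
        rw [show a + b - a - b = 0 by ring, sub_self, ibinomSum_zero_zero hm,
          ibinomSum_zero_of_not_dvd hdvd]
        simp
      · obtain ⟨f₁, e₁⟩ := ih (a + 1) b (by push_cast at hn; omega) (by omega) (by omega)
        obtain ⟨f₂, e₂⟩ := ih a (b + 1) (by push_cast at hn; omega) (by omega) (by omega)
        obtain ⟨hf, he⟩ := SPaths_finite_and_ncard
          (C := fun q : ℤ × ℤ => q.1 + s ≤ q.2 ∧ q.2 ≤ q.1 + t) hC hne
          (by simpa using f₁) (by simpa using f₂)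
        refine ⟨hf, ?_⟩
        simp only [Prod.mk_add_mk, add_zero] at he
        rw [he, Nat.cast_add, e₁, e₂]
        rcases Nat.eq_zero_or_pos n with rfl | hpos
        · have h0 : c + d - a - b = 0 := by push_cast at hn; omega
          have hca : c ≠ a := by
            rintro rfl
            exact hne (Prod.ext rfl (by simp only; omega))
          have hdvd : ¬ (t - s + 2) ∣ (c - b + t + 1) := fun h => by
            have := Int.le_of_dvd (by omega) h
            omega
          have hdvd' : ¬ (t - s + 2) ∣ (c - a) := fun h => by
            have := Int.eq_zero_of_abs_lt_dvd h (abs_lt.2 (by constructor <;> omega))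
            omega
          rw [h0, ibinomSum_zero_of_not_dvd hdvd, ibinomSum_zero_of_not_dvd hdvd']
          simp [ibinomSum_of_neg _ (show c + d - (a + 1) - b < 0 by omega),
            ibinomSum_of_neg _ (show c + d - a - (b + 1) < 0 by omega)]
        · have hpos' : 0 < c + d - a - b := by push_cast at hn; omega
          rw [ibinomSum_eq_add hm hpos' (c - a), ibinomSum_eq_add hm hpos' (c - b + t + 1),
            show c + d - (a + 1) - b = c + d - a - b - 1 by ring,
            show c + d - a - (b + 1) = c + d - a - b - 1 by ring,
            show c - (a + 1) = c - a - 1 by ring,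
            show c - (b + 1) + t + 1 = c - b + t + 1 - 1 by ring]
          ring
    · rw [SPaths_eq_empty_of_not hC]
      refine ⟨Set.finite_empty, ?_⟩
      rw [Set.ncard_empty, Nat.cast_zero, eq_comm, sub_eq_zero]
      rcases (show b = a + t + 1 ∨ b = a + s - 1 by omega) with rfl | rfl
      · congr 1
        ring
      · rw [← ibinomSum_add_period]
        congr 1
        ring

theorem statement2 (a b c d s t : ℤ)
    (h1 : a + s ≤ b) (h2 : b ≤ a + t) (h3 : c + s ≤ d) (h4 : d ≤ c + t) :
    ((SPaths (a, b) (c, d) (fun q => q.1 + s ≤ q.2 ∧ q.2 ≤ q.1 + t)).ncard : ℤ)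
      = ∑ᶠ k : ℤ, (ibinom (c + d - a - b) (c - a - k * (t - s + 2))
          - ibinom (c + d - a - b) (c - b - k * (t - s + 2) + t + 1)) := by
  have hm : 0 < t - s + 2 := by omega
  have hadd (k : ℤ) : c - b - k * (t - s + 2) + t + 1 = c - b + t + 1 - k * (t - s + 2) := by ring
  simp only [hadd]
  rw [finsum_sub_distrib (finite_support_ibinom_sub_mul _ _ hm)
    (finite_support_ibinom_sub_mul _ _ hm)]
  change _ = ibinomSum _ _ _ - ibinomSum _ _ _
  by_cases hn : c + d - a - b < 0
  · rw [SPaths_eq_empty_of_lt (by simp only; omega), ibinomSum_of_neg _ hn, ibinomSum_of_neg _ hn]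
    simp
  · exact (SPaths_strip_finite_and_ncard c d s t (by omega) h3 h4 (c + d - a - b + 1).toNat a b
      (by omega) (by omega) (by omega)).2
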